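/- Let μ ∈ ℝ, σ > 0, y⋆ ∈ ℝ, and set γ = (y⋆ − μ)/σ. Let q be the density of the normal distribution N(μ, σ²) and let p be the density of N(μ, σ²) truncated above at y⋆, i.e., p(y) = ψ((y − μ)/σ)/(σ·Ψ(γ)) for y < y⋆ and p(y) = 0 for y ≥ y⋆. Then (−∫ q(y)·log q(y) dy) − (−∫ p(y)·log p(y) dy) = γ·ψ(γ)/(2Ψ(γ)) − log Ψ(γ). -/

import Mathlib

open Real MeasureTheory

/-- The standard normal probability density function. -/
noncomputable def normalPdf (u : ℝ) : ℝ := (Real.sqrt (2 * Real.pi))⁻¹ * Real.exp (-u ^ 2 / 2)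

/-- The standard normal cumulative distribution function. -/
noncomputable def normalCdf (u : ℝ) : ℝ := ∫ t in Set.Iic u, normalPdf t

theorem npdf_pos (u : ℝ) : 0 < normalPdf u := by
  unfold normalPdf; positivity

theorem npdf_int : Integrable normalPdf := by
  have h := (integrable_exp_neg_mul_sq (b := 1 / 2) (by norm_num)).const_mul
    (Real.sqrt (2 * Real.pi))⁻¹
  refine h.congr (Filter.Eventually.of_forall fun x => ?_)
  simp only [normalPdf]
  ring_nf

theorem npdf_int1 : Integrable (fun u => u * normalPdf u) := by
  have h := (integrable_mul_exp_neg_mul_sq (b := 1 / 2) (by norm_num)).const_mul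
    (Real.sqrt (2 * Real.pi))⁻¹
  refine h.congr (Filter.Eventually.of_forall fun x => ?_)
  simp only [normalPdf]
  ring_nf

theorem npdf_int2 : Integrable (fun u => u ^ 2 * normalPdf u) := by
  have h := (integrable_rpow_mul_exp_neg_mul_sq (b := 1 / 2) (by norm_num)
    (s := 2) (by norm_num)).const_mul (Real.sqrt (2 * Real.pi))⁻¹
  refine h.congr (Filter.Eventually.of_forall fun x => ?_)
  simp only [normalPdf, Real.rpow_two]
  ring_nf

theorem npdf_one : ∫ u, normalPdf u = 1 := by
  have h := integral_gaussian (1 / 2)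
  have e : ∀ u, normalPdf u = (Real.sqrt (2 * Real.pi))⁻¹ * Real.exp (-(1 / 2) * u ^ 2) := by
    intro u
    simp only [normalPdf]
    ring_nf
  simp_rw [e]
  rw [integral_const_mul, h]
  have : Real.pi / (1 / 2) = 2 * Real.pi := by ring
  rw [this]
  have : 0 < Real.sqrt (2 * Real.pi) := by positivity
  field_simp

theorem npdf_deriv (u : ℝ) :
    HasDerivAt (fun u => u * normalPdf u) (normalPdf u - u ^ 2 * normalPdf u) u := by
  have h1 : HasDerivAt (fun u : ℝ => -u ^ 2 / 2) (-u) u := by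
    have := ((hasDerivAt_pow 2 u).neg).div_const 2
    exact this.congr_deriv (by simp; ring)
  have h2 : HasDerivAt normalPdf
      ((Real.sqrt (2 * Real.pi))⁻¹ * (Real.exp (-u ^ 2 / 2) * (-u))) u :=
    h1.exp.const_mul _
  have h3 := (hasDerivAt_id u).mul h2
  refine h3.congr_deriv ?_
  simp only [normalPdf, id]
  ring

theorem npdf_two : ∫ u, u ^ 2 * normalPdf u = 1 := by
  have h := integral_eq_zero_of_hasDerivAt_of_integrable npdf_deriv
    (npdf_int.sub npdf_int2) npdf_int1
  rw [integral_sub npdf_int npdf_int2, npdf_one] at h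
  linarith

theorem npdf_two_Iic (a : ℝ) :
    ∫ u in Set.Iic a, u ^ 2 * normalPdf u = normalCdf a - a * normalPdf a := by
  have ht := tendsto_zero_of_hasDerivAt_of_integrableOn_Iic (a := a)
    (fun x _ => npdf_deriv x) (npdf_int.sub npdf_int2).integrableOn npdf_int1.integrableOn
  have h := integral_Iic_of_hasDerivAt_of_tendsto' (a := a)
    (fun x _ => npdf_deriv x) (npdf_int.sub npdf_int2).integrableOn ht
  rw [integral_sub npdf_int.integrableOn npdf_int2.integrableOn] at h
  unfold normalCdf
  linarith

theorem ncdf_pos (a : ℝ) : 0 < normalCdf a := by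
  unfold normalCdf
  rw [setIntegral_pos_iff_support_of_nonneg_ae
    (Filter.Eventually.of_forall fun x => (npdf_pos x).le) npdf_int.integrableOn]
  have : Function.support normalPdf = Set.univ := by
    ext x
    simp [(npdf_pos x).ne']
  rw [this]
  simp

theorem npdf_log (u c : ℝ) (hc : 0 < c) :
    normalPdf u / c * Real.log (normalPdf u / c)
      = (-(Real.log (Real.sqrt (2 * Real.pi)) + Real.log c) / c) * normalPdf u
        - (1 / (2 * c)) * (u ^ 2 * normalPdf u) := by
  have h : Real.log (normalPdf u / c)
      = -Real.log (Real.sqrt (2 * Real.pi)) - u ^ 2 / 2 - Real.log c := by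
    rw [Real.log_div (npdf_pos u).ne' hc.ne', normalPdf,
      Real.log_mul (by positivity) (by positivity), Real.log_inv, Real.log_exp]
    ring
  rw [h]
  field_simp
  ring

theorem cov (f : ℝ → ℝ) (μ σ : ℝ) (hσ : 0 < σ) :
    ∫ y, f ((y - μ) / σ) = σ * ∫ u, f u := by
  rw [integral_sub_right_eq_self (fun y => f (y / σ)) μ, Measure.integral_comp_div,
    abs_of_pos hσ, smul_eq_mul]

/-- The entropy difference between `N(μ, σ²)` and its upper truncation at `y⋆` is exactly
the per-sample MES term `γψ(γ)/(2Ψ(γ)) − log Ψ(γ)`, where `γ = (y⋆ − μ)/σ`. -/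
theorem entropy_difference_eq_mes_term
    (μ σ ystar : ℝ) (hσ : 0 < σ)
    (γ : ℝ) (hγ : γ = (ystar - μ) / σ)
    (q p : ℝ → ℝ)
    (hq : ∀ y : ℝ, q y = normalPdf ((y - μ) / σ) / σ)
    (hp : ∀ y : ℝ,
      p y = if y < ystar then normalPdf ((y - μ) / σ) / (σ * normalCdf γ) else 0) :
    (-∫ y : ℝ, q y * Real.log (q y)) - (-∫ y : ℝ, p y * Real.log (p y))
      = γ * normalPdf γ / (2 * normalCdf γ) - Real.log (normalCdf γ) := by
  have hΨ := ncdf_pos γ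
  have hc : 0 < σ * normalCdf γ := mul_pos hσ hΨ
  have hQ : ∫ y : ℝ, q y * Real.log (q y)
      = σ * ((-(Real.log (Real.sqrt (2 * Real.pi)) + Real.log σ) / σ) - 1 / (2 * σ)) := by
    simp_rw [hq]
    rw [cov (fun u => normalPdf u / σ * Real.log (normalPdf u / σ)) μ σ hσ]
    simp_rw [npdf_log _ σ hσ]
    rw [integral_sub (npdf_int.const_mul _) (npdf_int2.const_mul _), integral_const_mul,
      integral_const_mul, npdf_one, npdf_two]
    ring
  have hP : ∫ y : ℝ, p y * Real.log (p y)
      = σ * ((-(Real.log (Real.sqrt (2 * Real.pi)) + Real.log (σ * normalCdf γ))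
          / (σ * normalCdf γ)) * normalCdf γ
          - 1 / (2 * (σ * normalCdf γ)) * (normalCdf γ - γ * normalPdf γ)) := by
    have e : ∀ y, p y * Real.log (p y) = (Set.Iio γ).indicator
        (fun u => normalPdf u / (σ * normalCdf γ)
          * Real.log (normalPdf u / (σ * normalCdf γ))) ((y - μ) / σ) := by
      intro y
      have hiff : (y - μ) / σ < γ ↔ y < ystar := by
        rw [hγ, div_lt_div_iff_of_pos_right hσ]
        simp
      rw [hp, Set.indicator_apply]
      simp only [Set.mem_Iio, hiff]
      split_ifs <;> simp
    simp_rw [e]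
    rw [cov _ μ σ hσ, integral_indicator measurableSet_Iio, ← integral_Iic_eq_integral_Iio]
    simp_rw [npdf_log _ _ hc]
    rw [integral_sub (npdf_int.const_mul _).integrableOn (npdf_int2.const_mul _).integrableOn,
      integral_const_mul, integral_const_mul, npdf_two_Iic]
    rfl
  rw [hQ, hP, Real.log_mul hσ.ne' hΨ.ne']
  field_simp
  ring
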